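/- For every m ≥ 1 and all positive integers d₁, …, d_m, one has w_c(d₁ + ⋯ + d_m) ≥ w_c(d₁) + ⋯ + w_c(d_m) (as elements of [0,∞]). -/

import Mathlib

open Set ENNReal

/-- The lattice width of a set `K ⊆ ℝ^ι` with respect to the integer lattice `ℤ^ι`. -/
noncomputable def latticeWidth {ι : Type*} (K : Set (ι → ℝ)) : ℝ :=
  sInf { w : ℝ | ∃ f : (ι → ℝ) →ₗ[ℝ] ℝ,
    (∀ v : ι → ℤ, ∃ k : ℤ, f (fun i => (v i : ℝ)) = (k : ℝ)) ∧ f ≠ 0 ∧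
    w = sSup (f '' K) - sInf (f '' K) }

/-- `w_c(n)`: the supremum in `[0,∞]` of the lattice widths of all hollow convex
bodies in `ℝ^n`. -/
noncomputable def wc (n : ℕ) : ℝ≥0∞ :=
  ⨆ (K : Set (Fin n → ℝ)) (_ : IsCompact K) (_ : Convex ℝ K)
    (_ : (interior K).Nonempty)
    (_ : ∀ z : Fin n → ℤ, (fun i => (z i : ℝ)) ∉ interior K),
    ENNReal.ofReal (latticeWidth K)

/-- The gauge of a convex body centred at an interior point `p`. -/
theorem exists_centred_gauge {E : Type*} [NormedAddCommGroup E] [NormedSpace ℝ E] {K : Set E}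
    (hK : Convex ℝ K) {p : E} (hp : p ∈ interior K) :
    ∃ g : E → ℝ, ConvexOn ℝ univ g ∧ Continuous g ∧ (∀ x, 0 ≤ g x) ∧
      (∀ x, g x < 1 → x ∈ interior K) ∧ (∀ x ∈ K, g x ≤ 1) ∧
      ∀ t : ℝ, 0 ≤ t → ∀ x, g (p + t • (x - p)) = t * g x := by
  set A : Set E := (fun x => p + x) ⁻¹' K with hA
  have hAc : Convex ℝ A := hK.translate_preimage_right p
  have hint : interior A = (fun x => p + x) ⁻¹' interior K :=
    ((Homeomorph.addLeft p).preimage_interior K).symm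
  have hA0 : A ∈ nhds (0 : E) := by
    rw [← mem_interior_iff_mem_nhds, hint]
    simpa using hp
  refine ⟨fun x => gauge A (x - p), ⟨convex_univ, ?_⟩, ?_, fun x => gauge_nonneg _, ?_, ?_, ?_⟩
  · intro x _ y _ a b ha hb hab
    have h : a • x + b • y - p = a • (x - p) + b • (y - p) := by
      have : p = (a + b) • p := by rw [hab, one_smul]
      nth_rewrite 1 [this]
      module
    simp only [h]
    refine (gauge_add_le hAc (absorbent_nhds_zero hA0) _ _).trans ?_
    rw [gauge_smul_of_nonneg ha, gauge_smul_of_nonneg hb]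
  · exact (continuous_gauge hAc hA0).comp (by fun_prop)
  · intro x hx
    have h : x - p ∈ interior A := by
      rw [← gauge_lt_one_iff_mem_interior hAc hA0]
      exact hx
    rw [hint] at h
    simpa using h
  · intro x hx
    exact gauge_le_one_of_mem (by simpa [hA] using hx)
  · intro t ht x
    simp only [add_sub_cancel_left, gauge_smul_of_nonneg ht, smul_eq_mul]

/-- A linear functional on `ℝ^ι` taking integer values on `ℤ^ι`. -/
def IsIntegerFunctional {ι : Type*} (f : (ι → ℝ) →ₗ[ℝ] ℝ) : Prop :=
  ∀ v : ι → ℤ, ∃ k : ℤ, f (fun i => (v i : ℝ)) = (k : ℝ)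

theorem sub_le_width {ι : Type*} [Finite ι] {K : Set (ι → ℝ)} (hK : IsCompact K)
    (f : (ι → ℝ) →ₗ[ℝ] ℝ) {u v : ι → ℝ} (hu : u ∈ K) (hv : v ∈ K) :
    f u - f v ≤ sSup (f '' K) - sInf (f '' K) := by
  have hc : IsCompact (f '' K) := hK.image f.continuous_of_finiteDimensional
  exact sub_le_sub (le_csSup hc.bddAbove (mem_image_of_mem f hu))
    (csInf_le hc.bddBelow (mem_image_of_mem f hv))

theorem latticeWidth_le_width {ι : Type*} [Finite ι] {K : Set (ι → ℝ)} (hK : IsCompact K)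
    (hne : K.Nonempty) {f : (ι → ℝ) →ₗ[ℝ] ℝ} (hf : IsIntegerFunctional f) (hf0 : f ≠ 0) :
    ∃ u ∈ K, ∃ v ∈ K, latticeWidth K ≤ f u - f v := by
  have hc : IsCompact (f '' K) := hK.image f.continuous_of_finiteDimensional
  obtain ⟨u, hu, hfu⟩ := hc.sSup_mem (hne.image f)
  obtain ⟨v, hv, hfv⟩ := hc.sInf_mem (hne.image f)
  refine ⟨u, hu, v, hv, ?_⟩
  rw [hfu, hfv]
  refine csInf_le ⟨0, ?_⟩ ⟨f, hf, hf0, rfl⟩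
  rintro _ ⟨g, -, -, rfl⟩
  simpa using sub_le_width hK g hne.some_mem hne.some_mem

theorem le_latticeWidth {ι : Type*} [Nonempty ι] {K : Set (ι → ℝ)} {c : ℝ}
    (h : ∀ f : (ι → ℝ) →ₗ[ℝ] ℝ, IsIntegerFunctional f → f ≠ 0 →
      c ≤ sSup (f '' K) - sInf (f '' K)) : c ≤ latticeWidth K := by
  refine le_csInf ?_ ?_
  · obtain ⟨i⟩ := ‹Nonempty ι›
    refine ⟨_, LinearMap.proj i, fun v => ⟨v i, rfl⟩, fun h0 => ?_, rfl⟩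
    have := LinearMap.congr_fun h0 (fun _ => 1)
    simp at this
  · rintro _ ⟨f, hf, hf0, rfl⟩
    exact h f hf hf0

theorem latticeWidth_pos {ι : Type*} [Fintype ι] [Nonempty ι] {K : Set (ι → ℝ)}
    (hK : IsCompact K) (hne : (interior K).Nonempty) : 0 < latticeWidth K := by
  classical
  obtain ⟨p, hp⟩ := hne
  obtain ⟨r, hr, hball⟩ := Metric.nhds_basis_closedBall.mem_iff.1 (mem_interior_iff_mem_nhds.1 hp)
  refine hr.trans_le (le_latticeWidth fun f hf hf0 => ?_)
  obtain ⟨i, hi⟩ : ∃ i, f (Pi.single i 1) ≠ 0 := by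
    by_contra! h
    exact hf0 (LinearMap.pi_ext' fun i => LinearMap.ext_ring (by simpa using h i))
  obtain ⟨k, hk⟩ := hf (Pi.single i 1)
  have hcast : (fun j => ((Pi.single i 1 : ι → ℤ) j : ℝ)) = Pi.single i 1 := by
    ext j
    by_cases h : j = i <;> simp [h]
  rw [hcast] at hk
  have hk0 : k ≠ 0 := by
    rintro rfl
    exact hi (by simpa using hk)
  have habs : (1 : ℝ) ≤ |(k : ℝ)| := by exact_mod_cast Int.one_le_abs hk0
  have hmem : ∀ s : ℝ, |s| = r → p + s • Pi.single i 1 ∈ K := fun s hs => hball (by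
    rw [mem_closedBall_iff_norm, add_sub_cancel_left, norm_smul, Real.norm_eq_abs, hs,
      Pi.norm_single, norm_one, mul_one])
  have hpK : p ∈ K := interior_subset hp
  rcases abs_cases (k : ℝ) with ⟨h, -⟩ | ⟨h, -⟩
  · have := sub_le_width hK f (hmem r (abs_of_pos hr)) hpK
    rw [map_add, map_smul, hk, smul_eq_mul, add_sub_cancel_left] at this
    nlinarith
  · have := sub_le_width hK f (hmem (-r) (by rw [abs_neg, abs_of_pos hr])) hpK
    rw [map_add, map_smul, hk, smul_eq_mul, add_sub_cancel_left] at this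
    nlinarith

/-- A hollow convex body in `ℝ^n`. -/
structure IsHollowBody {n : ℕ} (K : Set (Fin n → ℝ)) : Prop where
  isCompact : IsCompact K
  convex : Convex ℝ K
  nonempty : (interior K).Nonempty
  hollow : ∀ z : Fin n → ℤ, (fun i => (z i : ℝ)) ∉ interior K

theorem wc_eq_iSup (n : ℕ) :
    wc n = ⨆ (K : Set (Fin n → ℝ)) (_ : IsHollowBody K), ENNReal.ofReal (latticeWidth K) := by
  refine le_antisymm ?_ ?_
  · exact iSup_le fun K => iSup_le fun h₁ => iSup_le fun h₂ => iSup_le fun h₃ => iSup_le fun h₄ =>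
      le_iSup₂_of_le K ⟨h₁, h₂, h₃, h₄⟩ le_rfl
  · exact iSup₂_le fun K h => le_iSup_of_le K <| le_iSup_of_le h.1 <| le_iSup_of_le h.2 <|
      le_iSup_of_le h.3 <| le_iSup_of_le h.4 le_rfl

theorem exists_isHollowBody {n : ℕ} (hn : 0 < n) : ∃ K : Set (Fin n → ℝ), IsHollowBody K := by
  have hint : interior (univ.pi fun _ : Fin n => Icc (0 : ℝ) 1) = univ.pi fun _ => Ioo 0 1 := by
    rw [interior_pi_set finite_univ]
    simp only [interior_Icc]
  refine ⟨univ.pi fun _ => Icc 0 1, isCompact_univ_pi fun _ => isCompact_Icc,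
    convex_pi fun _ _ => convex_Icc 0 1, ?_, fun z hz => ?_⟩
  · rw [hint]
    exact ⟨fun _ => 1 / 2, fun _ _ => by norm_num⟩
  · rw [hint] at hz
    obtain ⟨h₀, h₁⟩ := hz ⟨0, hn⟩ (mem_univ _)
    have h₀' : 0 < z ⟨0, hn⟩ := Int.cast_pos.1 h₀
    have h₁' : z ⟨0, hn⟩ < 1 := by exact_mod_cast (show (z ⟨0, hn⟩ : ℝ) < 1 from h₁)
    omega

/-- The inclusion of `ℝ^a` as the first factor of `ℝ^(a+b)`. -/
def inclLeft (a b : ℕ) : (Fin a → ℝ) →ₗ[ℝ] (Fin (a + b) → ℝ) where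
  toFun x := Fin.append x 0
  map_add' x y := by ext i; refine Fin.addCases (fun i => ?_) (fun i => ?_) i <;> simp
  map_smul' c x := by ext i; refine Fin.addCases (fun i => ?_) (fun i => ?_) i <;> simp

/-- The inclusion of `ℝ^b` as the second factor of `ℝ^(a+b)`. -/
def inclRight (a b : ℕ) : (Fin b → ℝ) →ₗ[ℝ] (Fin (a + b) → ℝ) where
  toFun x := Fin.append 0 x
  map_add' x y := by ext i; refine Fin.addCases (fun i => ?_) (fun i => ?_) i <;> simp
  map_smul' c x := by ext i; refine Fin.addCases (fun i => ?_) (fun i => ?_) i <;> simp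

theorem IsIntegerFunctional.comp_inclLeft {a b : ℕ} {f : (Fin (a + b) → ℝ) →ₗ[ℝ] ℝ}
    (hf : IsIntegerFunctional f) : IsIntegerFunctional (f ∘ₗ inclLeft a b) := by
  intro v
  obtain ⟨k, hk⟩ := hf (Fin.append v 0)
  refine ⟨k, hk ▸ congrArg f ?_⟩
  ext i
  refine Fin.addCases (fun i => ?_) (fun i => ?_) i <;> simp [inclLeft]

theorem IsIntegerFunctional.comp_inclRight {a b : ℕ} {f : (Fin (a + b) → ℝ) →ₗ[ℝ] ℝ}
    (hf : IsIntegerFunctional f) : IsIntegerFunctional (f ∘ₗ inclRight a b) := by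
  intro v
  obtain ⟨k, hk⟩ := hf (Fin.append 0 v)
  refine ⟨k, hk ▸ congrArg f ?_⟩
  ext i
  refine Fin.addCases (fun i => ?_) (fun i => ?_) i <;> simp [inclRight]

theorem append_eq_incl_add {a b : ℕ} (u : Fin a → ℝ) (v : Fin b → ℝ) :
    Fin.append u v = inclLeft a b u + inclRight a b v := by
  ext i
  refine Fin.addCases (fun i => ?_) (fun i => ?_) i <;> simp [inclLeft, inclRight]

/-- A compact set of which a dilated copy is embedded in `K` bounds the width of `K`. -/
theorem mul_latticeWidth_le_width {ι κ : Type*} [Finite ι] [Finite κ] {L : Set (ι → ℝ)}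
    {K : Set (κ → ℝ)} (hL : IsCompact L) (hne : L.Nonempty) (hK : IsCompact K)
    (J : (ι → ℝ) →ₗ[ℝ] (κ → ℝ)) {c : ℝ} (hc : 0 ≤ c) (q : κ → ℝ)
    (hLK : ∀ x ∈ L, q + c • J x ∈ K) {f : (κ → ℝ) →ₗ[ℝ] ℝ}
    (hf : IsIntegerFunctional (f ∘ₗ J)) (hf0 : f ∘ₗ J ≠ 0) :
    c * latticeWidth L ≤ sSup (f '' K) - sInf (f '' K) := by
  obtain ⟨u, hu, v, hv, huv⟩ := latticeWidth_le_width hL hne hf hf0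
  have h := sub_le_width hK f (hLK u hu) (hLK v hv)
  simp only [map_add, map_smul, smul_eq_mul] at h
  simp only [LinearMap.comp_apply] at huv
  nlinarith [mul_le_mul_of_nonneg_left huv hc]

/-- The sublevel sets of the centred gauge of a compact set are contained in compact sets. -/
theorem exists_isCompact_sublevel {E : Type*} [NormedAddCommGroup E] [NormedSpace ℝ E]
    {K : Set E} (hK : IsCompact K) {p : E} {g : E → ℝ} (hlt : ∀ x, g x < 1 → x ∈ interior K)
    (hhom : ∀ t : ℝ, 0 ≤ t → ∀ x, g (p + t • (x - p)) = t * g x) {r : ℝ} (hr : 0 ≤ r) :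
    ∃ C : Set E, IsCompact C ∧ ∀ x, g x ≤ r → x ∈ C := by
  refine ⟨(fun z => p + (r + 1) • (z - p)) '' K, hK.image (by fun_prop), fun x hx => ?_⟩
  have hr1 : 0 < r + 1 := by linarith
  refine ⟨p + (r + 1)⁻¹ • (x - p), interior_subset (hlt _ ?_), ?_⟩
  · rw [hhom _ (by positivity), inv_mul_lt_iff₀ hr1]
    linarith
  · simp [smul_smul, hr1.ne']

/-- The weighted direct sum of two hollow bodies is hollow, with lattice width at least the sum of
the two lattice widths. -/
theorem IsHollowBody.exists_add_le {a b : ℕ} (ha : 0 < a) (hb : 0 < b) {K : Set (Fin a → ℝ)}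
    {L : Set (Fin b → ℝ)} (hK : IsHollowBody K) (hL : IsHollowBody L) :
    ∃ S : Set (Fin (a + b) → ℝ), IsHollowBody S ∧
      latticeWidth K + latticeWidth L ≤ latticeWidth S := by
  have : Nonempty (Fin a) := ⟨⟨0, ha⟩⟩
  have : Nonempty (Fin b) := ⟨⟨0, hb⟩⟩
  have : Nonempty (Fin (a + b)) := ⟨⟨0, by omega⟩⟩
  have hwK := latticeWidth_pos hK.isCompact hK.nonempty
  have hwL := latticeWidth_pos hL.isCompact hL.nonempty
  set wK := latticeWidth K
  set wL := latticeWidth L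
  obtain ⟨p, hp⟩ := hK.nonempty
  obtain ⟨q, hq⟩ := hL.nonempty
  obtain ⟨g, gconv, gcont, gnonneg, glt, gle, ghom⟩ := exists_centred_gauge hK.convex hp
  obtain ⟨h, hconv, hcont, hnonneg, hlt, hle, hhom⟩ := exists_centred_gauge hL.convex hq
  have gp : g p = 0 := by simpa using ghom 0 le_rfl p
  have hq0 : h q = 0 := by simpa using hhom 0 le_rfl q
  let P : (Fin (a + b) → ℝ) →ₗ[ℝ] (Fin a → ℝ) := LinearMap.funLeft ℝ ℝ (Fin.castAdd b)
  let Q : (Fin (a + b) → ℝ) →ₗ[ℝ] (Fin b → ℝ) := LinearMap.funLeft ℝ ℝ (Fin.natAdd a)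
  have hPapp : ∀ u v, P (Fin.append u v) = u := fun u v => by
    ext i; simp [P, LinearMap.funLeft_apply]
  have hQapp : ∀ u v, Q (Fin.append u v) = v := fun u v => by
    ext i; simp [Q, LinearMap.funLeft_apply]
  have happ : ∀ y, Fin.append (P y) (Q y) = y := fun y => by
    ext i; refine Fin.addCases (fun i => ?_) (fun i => ?_) i <;> simp [P, Q, LinearMap.funLeft_apply]
  have hPc : Continuous P := P.continuous_of_finiteDimensional
  have hQc : Continuous Q := Q.continuous_of_finiteDimensional
  let G : (Fin (a + b) → ℝ) → ℝ := fun y => wK * g (P y) + wL * h (Q y)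
  have hGc : Continuous G := by fun_prop
  have hGconv : ConvexOn ℝ univ G :=
    ((gconv.comp_linearMap P).smul hwK.le).add ((hconv.comp_linearMap Q).smul hwL.le)
  have hw : 0 < wK + wL := by positivity
  let S : Set (Fin (a + b) → ℝ) := {y | G y ≤ wK + wL}
  let c : Fin (a + b) → ℝ := Fin.append p q
  have hGhom : ∀ t : ℝ, 0 ≤ t → ∀ y, G (c + t • (y - c)) = t * G y := fun t ht y => by
    simp only [G, c, map_add, map_smul, map_sub, hPapp, hQapp, ghom t ht, hhom t ht]
    ring
  have hScompact : IsCompact S := by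
    obtain ⟨C, hC, hCmem⟩ := exists_isCompact_sublevel hK.isCompact glt ghom
      (r := (wK + wL) / wK) (by positivity)
    obtain ⟨D, hD, hDmem⟩ := exists_isCompact_sublevel hL.isCompact hlt hhom
      (r := (wK + wL) / wL) (by positivity)
    have hcomp : IsCompact ((fun z : (Fin a → ℝ) × (Fin b → ℝ) =>
        inclLeft a b z.1 + inclRight a b z.2) '' C ×ˢ D) :=
      (hC.prod hD).image
        (((inclLeft a b).continuous_of_finiteDimensional.comp continuous_fst).add
          ((inclRight a b).continuous_of_finiteDimensional.comp continuous_snd))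
    refine hcomp.of_isClosed_subset (isClosed_le hGc continuous_const) fun y hy => ?_
    have hy' : wK * g (P y) + wL * h (Q y) ≤ wK + wL := hy
    refine ⟨(P y, Q y), ⟨hCmem _ ?_, hDmem _ ?_⟩, ?_⟩
    · rw [le_div_iff₀ hwK]
      nlinarith [mul_nonneg hwL.le (hnonneg (Q y))]
    · rw [le_div_iff₀ hwL]
      nlinarith [mul_nonneg hwK.le (gnonneg (P y))]
    · simp only [← append_eq_incl_add, happ]
  have hGint : ∀ y ∈ interior S, G y < wK + wL := fun y hy => by
    have hcont' : Continuous fun t : ℝ => c + t • (y - c) := by fun_prop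
    have hev : ∀ᶠ t in nhds (1 : ℝ), c + t • (y - c) ∈ S := by
      refine hcont'.continuousAt.eventually_mem ?_
      simpa using mem_interior_iff_mem_nhds.1 hy
    obtain ⟨t, ht, ht1⟩ := ((hev.filter_mono nhdsWithin_le_nhds).and
      (self_mem_nhdsWithin : Ioi (1 : ℝ) ∈ nhdsWithin 1 (Ioi 1))).exists
    have ht1' : 1 < t := ht1
    have ht' : t * G y ≤ wK + wL := by
      rw [← hGhom t (by linarith) y]
      exact ht
    by_contra! hcon
    nlinarith
  refine ⟨S, ⟨hScompact, ?_, ⟨c, ?_⟩, fun z hz => ?_⟩, le_latticeWidth fun f hf hf0 => ?_⟩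
  · simpa [S] using hGconv.convex_le (wK + wL)
  · refine interior_maximal (fun y (hy : G y < wK + wL) => hy.le)
      (isOpen_lt hGc continuous_const) ?_
    change G c < wK + wL
    simpa [G, c, hPapp, hQapp, gp, hq0] using hw
  · have hlt' : wK * g (P _) + wL * h (Q _) < wK + wL := hGint _ hz
    by_cases hcase : g (P fun i => (z i : ℝ)) < 1
    · exact hK.hollow (fun i => z (Fin.castAdd b i)) (glt _ hcase)
    · refine hL.hollow (fun i => z (Fin.natAdd a i)) (hlt _ (lt_of_not_ge fun hge => ?_))
      have hge' : 1 ≤ h (Q fun i => (z i : ℝ)) := hge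
      nlinarith
  · by_cases hfK : f ∘ₗ inclLeft a b = 0
    · have hfL : f ∘ₗ inclRight a b ≠ 0 := fun hfL => hf0 <| LinearMap.ext fun y => by
        have h₁ := LinearMap.congr_fun hfK (P y)
        have h₂ := LinearMap.congr_fun hfL (Q y)
        simp only [LinearMap.comp_apply, LinearMap.zero_apply] at h₁ h₂
        rw [← happ y, append_eq_incl_add, map_add, h₁, h₂, add_zero, LinearMap.zero_apply]
      have key := mul_latticeWidth_le_width hL.isCompact ⟨q, interior_subset hq⟩ hScompact
        (inclRight a b) (c := (wK + wL) / wL) (by positivity)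
        (c - ((wK + wL) / wL) • inclRight a b q) ?_ hf.comp_inclRight hfL
      · rwa [div_mul_cancel₀ _ hwL.ne'] at key
      · intro x hx
        have heq : c - ((wK + wL) / wL) • inclRight a b q + ((wK + wL) / wL) • inclRight a b x =
            c + ((wK + wL) / wL) • (Fin.append p x - c) := by
          simp only [c, append_eq_incl_add]
          module
        rw [heq]
        change G _ ≤ _
        rw [hGhom _ (by positivity), div_mul_eq_mul_div, div_le_iff₀ hwL]
        simp only [G, hPapp, hQapp, gp]
        nlinarith [mul_le_mul_of_nonneg_left (hle x hx) (mul_pos hw hwL).le]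
    · have key := mul_latticeWidth_le_width hK.isCompact ⟨p, interior_subset hp⟩ hScompact
        (inclLeft a b) (c := (wK + wL) / wK) (by positivity)
        (c - ((wK + wL) / wK) • inclLeft a b p) ?_ hf.comp_inclLeft hfK
      · rwa [div_mul_cancel₀ _ hwK.ne'] at key
      · intro x hx
        have heq : c - ((wK + wL) / wK) • inclLeft a b p + ((wK + wL) / wK) • inclLeft a b x =
            c + ((wK + wL) / wK) • (Fin.append x q - c) := by
          simp only [c, append_eq_incl_add]
          module
        rw [heq]
        change G _ ≤ _
        rw [hGhom _ (by positivity), div_mul_eq_mul_div, div_le_iff₀ hwK]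
        simp only [G, hPapp, hQapp, hq0]
        nlinarith [mul_le_mul_of_nonneg_left (gle x hx) (mul_pos hw hwK).le]

theorem wc_add_le {a b : ℕ} (ha : 0 < a) (hb : 0 < b) : wc a + wc b ≤ wc (a + b) := by
  simp only [wc_eq_iSup]
  refine ENNReal.biSup_add_biSup_le' (exists_isHollowBody ha) (exists_isHollowBody hb)
    fun K hK L hL => ?_
  obtain ⟨S, hS, hle⟩ := hK.exists_add_le ha hb hL
  have : Nonempty (Fin a) := ⟨⟨0, ha⟩⟩
  have : Nonempty (Fin b) := ⟨⟨0, hb⟩⟩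
  rw [← ENNReal.ofReal_add (latticeWidth_pos hK.isCompact hK.nonempty).le
    (latticeWidth_pos hL.isCompact hL.nonempty).le]
  exact le_iSup₂_of_le S hS (ENNReal.ofReal_le_ofReal hle)

theorem wc_superadditive (m : ℕ) (hm : 1 ≤ m) (d : Fin m → ℕ) (hd : ∀ i, 0 < d i) :
    ∑ i, wc (d i) ≤ wc (∑ i, d i) := by
  induction m, hm using Nat.le_induction with
  | base => simp
  | succ m hm ih =>
    rw [Fin.sum_univ_succ, Fin.sum_univ_succ]
    have hpos : 0 < ∑ i : Fin m, d i.succ :=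
      Finset.sum_pos (fun i _ => hd i.succ) ⟨⟨0, hm⟩, Finset.mem_univ _⟩
    exact (add_le_add le_rfl (ih (fun i => d i.succ) fun i => hd i.succ)).trans
      (wc_add_le (hd 0) hpos)
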